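/- If A is a σ-finite von Neumann algebra and T a Markov operator on A admitting at least one stationary normal state, then the maximal positive recurrent projection p_R is itself the support of a single stationary normal state. -/

import Mathlib

open Filter Topology ContinuousLinearMap

namespace QMP

variable {H : Type*} [NormedAddCommGroup H] [InnerProductSpace ℂ H] [CompleteSpace H]

/-- `T` is a (quantum) Markov operator on the von Neumann algebra `A`:
a normal, unital, completely positive linear map leaving `A` invariant. -/
structure IsMarkov (A : VonNeumannAlgebra H) (T : (H →L[ℂ] H) → (H →L[ℂ] H)) : Prop where
  linear : IsLinearMap ℂ T
  mapsSelf : ∀ x ∈ A, T x ∈ A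
  unital : T 1 = 1
  cp : ∀ (n : ℕ) (a b : Fin n → (H →L[ℂ] H)),
    0 ≤ ∑ i : Fin n, ∑ j : Fin n, star (b i) * T (star (a i) * a j) * b j
  normal : ∀ {ι : Type} [Preorder ι] [IsDirected ι (· ≤ ·)] (f : ι → (H →L[ℂ] H))
    (y : H →L[ℂ] H), Monotone f → IsLUB (Set.range f) y →
      IsLUB (Set.range fun i => T (f i)) (T y)

/-- `y = ∑ₙ Tⁿ x` with convergence in the strong operator topology. -/
def SOTSum (T : (H →L[ℂ] H) → (H →L[ℂ] H)) (x y : H →L[ℂ] H) : Prop :=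
  ∀ η : H, Tendsto (fun N => ∑ n ∈ Finset.range N, (T^[n] x) η) atTop (𝓝 (y η))

/-- `x ∈ A₊` is `T`-summable: `∑ₙ Tⁿ x` converges strongly to an element of `A₊`. -/
def TSummable (A : VonNeumannAlgebra H) (T : (H →L[ℂ] H) → (H →L[ℂ] H))
    (x : H →L[ℂ] H) : Prop :=
  x ∈ A ∧ 0 ≤ x ∧ ∃ y, y ∈ A ∧ 0 ≤ y ∧ SOTSum T x y

/-- `y` is a potential for `T`: `y = ∑ₙ Tⁿ x` for some `x ∈ A₊`. -/
def IsPotential (A : VonNeumannAlgebra H) (T : (H →L[ℂ] H) → (H →L[ℂ] H))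
    (y : H →L[ℂ] H) : Prop :=
  y ∈ A ∧ 0 ≤ y ∧ ∃ x, x ∈ A ∧ 0 ≤ x ∧ SOTSum T x y

/-- `p` is an orthogonal projection belonging to `A`. -/
def IsProj (A : VonNeumannAlgebra H) (p : H →L[ℂ] H) : Prop :=
  p ∈ A ∧ IsSelfAdjoint p ∧ IsIdempotentElem p

/-- `p` is the support projection of the self-adjoint element `a`. -/
def IsSupport (A : VonNeumannAlgebra H) (a p : H →L[ℂ] H) : Prop :=
  IsProj A p ∧ a = p * a * p ∧ ∀ q, IsProj A q → a = q * a * q → p ≤ q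

/-- `s` is the supremum of the family of projections `q` in the projection lattice of `A`. -/
def IsProjSup (A : VonNeumannAlgebra H) {ι : Type*} (q : ι → (H →L[ℂ] H))
    (s : H →L[ℂ] H) : Prop :=
  IsProj A s ∧ (∀ i, q i ≤ s) ∧ ∀ r, IsProj A r → (∀ i, q i ≤ r) → s ≤ r

end QMP

namespace QMP

variable {H : Type*} [NormedAddCommGroup H] [InnerProductSpace ℂ H] [CompleteSpace H]

/-- `p` is a transient projection for `T`: it is dominated by the supremum of a family of
`T`-summable projections. -/
def Transient (A : VonNeumannAlgebra H) (T : (H →L[ℂ] H) → (H →L[ℂ] H))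
    (p : H →L[ℂ] H) : Prop :=
  ∃ (ι : Type) (q : ι → (H →L[ℂ] H)) (s : H →L[ℂ] H),
    (∀ i, IsProj A (q i) ∧ TSummable A T (q i)) ∧ IsProjSup A q s ∧ p ≤ s

/-- `e` is the maximal transient projection `p_Tr`: the supremum of all transient
projections of `A`. -/
def IsMaxTransient (A : VonNeumannAlgebra H) (T : (H →L[ℂ] H) → (H →L[ℂ] H))
    (e : H →L[ℂ] H) : Prop :=
  IsProj A e ∧ (∀ p, IsProj A p → Transient A T p → p ≤ e) ∧
    ∀ r, IsProj A r → (∀ p, IsProj A p → Transient A T p → p ≤ r) → e ≤ r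

end QMP

namespace QMP

variable {H : Type*} [NormedAddCommGroup H] [InnerProductSpace ℂ H] [CompleteSpace H]

/-- A normal state on the von Neumann algebra `A`: a positive unital linear functional which
is continuous along bounded monotone sequences converging in the strong operator topology. -/
structure IsNormalState (A : VonNeumannAlgebra H) (φ : (H →L[ℂ] H) → ℂ) : Prop where
  linear : IsLinearMap ℂ φ
  unital : φ 1 = 1
  pos : ∀ x : H →L[ℂ] H, 0 ≤ x → ∃ r : ℝ, 0 ≤ r ∧ φ x = r
  normal : ∀ (f : ℕ → (H →L[ℂ] H)) (y : H →L[ℂ] H), (∀ n, f n ∈ A) → Monotone f →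
    (∀ η : H, Filter.Tendsto (fun n => (f n) η) Filter.atTop (nhds (y η))) →
    Filter.Tendsto (fun n => φ (f n)) Filter.atTop (nhds (φ y))

/-- `φ` is stationary for `T`: `φ ∘ T = φ`. -/
def Stationary (T : (H →L[ℂ] H) → (H →L[ℂ] H)) (φ : (H →L[ℂ] H) → ℂ) : Prop :=
  ∀ x : H →L[ℂ] H, φ (T x) = φ x

/-- `s` is the support projection of the state `φ`: the smallest projection `p ∈ A` with
`φ x = φ (p x p)` for all `x ∈ A`. -/
def IsStateSupport (A : VonNeumannAlgebra H) (φ : (H →L[ℂ] H) → ℂ)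
    (s : H →L[ℂ] H) : Prop :=
  IsProj A s ∧ (∀ x ∈ A, φ x = φ (s * x * s)) ∧
    ∀ q, IsProj A q → (∀ x ∈ A, φ x = φ (q * x * q)) → s ≤ q

/-- `r` is the maximal positive recurrent projection `p_R`: the supremum of the supports of
all stationary normal states of `T`. -/
def IsMaxPosRecurrent (A : VonNeumannAlgebra H) (T : (H →L[ℂ] H) → (H →L[ℂ] H))
    (r : H →L[ℂ] H) : Prop :=
  IsProj A r ∧
    (∀ φ s, IsNormalState A φ → Stationary T φ → IsStateSupport A φ s → s ≤ r) ∧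
    ∀ q, IsProj A q →
      (∀ φ s, IsNormalState A φ → Stationary T φ → IsStateSupport A φ s → s ≤ q) → r ≤ q

end QMP

namespace QMP
open scoped ComplexOrder

section
variable {H : Type*} [NormedAddCommGroup H] [InnerProductSpace ℂ H] [CompleteSpace H]
  {A : VonNeumannAlgebra H} {φ : (H →L[ℂ] H) → ℂ} {p q : H →L[ℂ] H}

lemma IsProj.isStarProjection (hp : IsProj A p) : IsStarProjection p := ⟨hp.2.2, hp.2.1⟩

lemma IsProj.one_sub (hp : IsProj A p) : IsProj A (1 - p) :=
  ⟨sub_mem (one_mem A) hp.1, hp.isStarProjection.one_sub.isSelfAdjoint,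
    hp.isStarProjection.one_sub.isIdempotentElem⟩

/-- A normal state as a bundled positive linear functional. -/
noncomputable def IsNormalState.toPositiveLinearMap (h : IsNormalState A φ) :
    (H →L[ℂ] H) →ₚ[ℂ] ℂ :=
  PositiveLinearMap.mk₀ (IsLinearMap.mk' φ h.linear) fun x hx => by
    obtain ⟨r, hr, hx⟩ := h.pos x hx
    simpa [hx] using hr

namespace IsNormalState

lemma toPositiveLinearMap_apply (h : IsNormalState A φ) (x : H →L[ℂ] H) :
    h.toPositiveLinearMap x = φ x := rfl

lemma nonneg (h : IsNormalState A φ) {x : H →L[ℂ] H} (hx : 0 ≤ x) : 0 ≤ φ x :=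
  h.toPositiveLinearMap.map_nonneg hx

lemma mono (h : IsNormalState A φ) {x y : H →L[ℂ] H} (hxy : x ≤ y) : φ x ≤ φ y :=
  OrderHomClass.mono h.toPositiveLinearMap hxy

lemma map_sub (h : IsNormalState A φ) (x y : H →L[ℂ] H) : φ (x - y) = φ x - φ y :=
  _root_.map_sub h.toPositiveLinearMap x y

lemma eq_zero_of_le (h : IsNormalState A φ) {x y : H →L[ℂ] H} (hx : 0 ≤ x) (hxy : x ≤ y)
    (hy : φ y = 0) : φ x = 0 :=
  le_antisymm (hy ▸ h.mono hxy) (h.nonneg hx)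

/-- The Cauchy–Schwarz inequality for a state. -/
lemma norm_map_star_mul_sq_le (h : IsNormalState A φ) (x y : H →L[ℂ] H) :
    ‖φ (star x * y)‖ ^ 2 ≤ (φ (star x * x)).re * (φ (star y * y)).re := by
  set f := h.toPositiveLinearMap
  have key := norm_inner_le_norm (𝕜 := ℂ) (f.toPreGNS x) (f.toPreGNS y)
  rw [PositiveLinearMap.preGNS_inner_def] at key
  have e (z : H →L[ℂ] H) : ‖f.toPreGNS z‖ ^ 2 = (φ (star z * z)).re := by
    have := congrArg Complex.re (f.preGNS_norm_sq (f.toPreGNS z))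
    rw [← Complex.ofReal_pow, Complex.ofReal_re] at this
    exact this
  rw [← e, ← e, ← mul_pow]
  exact pow_le_pow_left₀ (norm_nonneg _) key 2

lemma map_star_mul_eq_zero (h : IsNormalState A φ) {x : H →L[ℂ] H} (hx : φ (star x * x) = 0)
    (y : H →L[ℂ] H) : φ (star x * y) = 0 := by
  simpa [hx] using h.norm_map_star_mul_sq_le x y

lemma map_star_mul_eq_zero' (h : IsNormalState A φ) {x : H →L[ℂ] H} (hx : φ (star x * x) = 0)
    (y : H →L[ℂ] H) : φ (star y * x) = 0 := by
  simpa [hx] using h.norm_map_star_mul_sq_le y x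

lemma norm_le (h : IsNormalState A φ) (x : H →L[ℂ] H) : ‖φ x‖ ≤ ‖x‖ := by
  have key := h.norm_map_star_mul_sq_le 1 x
  simp only [star_one, one_mul, h.unital, Complex.one_re] at key
  have hle : star x * x ≤ ((‖x‖ ^ 2 : ℝ) : ℂ) • (1 : H →L[ℂ] H) := by
    have := CStarAlgebra.star_mul_le_algebraMap_norm_sq (a := x)
    rwa [Algebra.algebraMap_eq_smul_one, ← Complex.coe_smul] at this
  have h2 := (Complex.le_def.1 (h.mono hle)).1
  rw [h.linear.map_smul, h.unital] at h2
  simp only [smul_eq_mul, mul_one, Complex.ofReal_re] at h2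
  exact le_of_sq_le_sq (key.trans h2) (norm_nonneg _)

end IsNormalState

/-- The limit of a sequence in a von Neumann algebra for the strong operator topology belongs to
the algebra. -/
lemma mem_of_tendsto_apply {f : ℕ → H →L[ℂ] H} {y : H →L[ℂ] H} (hf : ∀ n, f n ∈ A)
    (h : ∀ η, Tendsto (fun n => f n η) atTop (𝓝 (y η))) : y ∈ A := by
  rw [← VonNeumannAlgebra.commutant_commutant A, VonNeumannAlgebra.mem_commutant_iff]
  intro g hg
  rw [VonNeumannAlgebra.mem_commutant_iff] at hg
  ext η
  refine tendsto_nhds_unique ((g.continuous.tendsto _).comp (h η)) ((h (g η)).congr fun n => ?_)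
  exact congrArg (fun z : H →L[ℂ] H => z η) (hg (f n) (hf n))

lemma smul_mem (c : ℂ) {x : H →L[ℂ] H} (hx : x ∈ A) : c • x ∈ A :=
  A.toStarSubalgebra.smul_mem hx c

/-- The Cesàro means of the powers of an operator between `0` and `1` decrease. -/
lemma antitone_average_pow {b : H →L[ℂ] H} (h0 : 0 ≤ b) (h1 : b ≤ 1) :
    Antitone fun n : ℕ => ((n + 1 : ℕ) : ℂ)⁻¹ • ∑ k ∈ Finset.range (n + 1), b ^ k := by
  refine antitone_nat_of_succ_le fun n => ?_
  have hn : ((n + 1 : ℕ) : ℂ) ≠ 0 := by exact_mod_cast n.succ_ne_zero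
  have hn' : ((n + 1 + 1 : ℕ) : ℂ) ≠ 0 := by exact_mod_cast (n + 1).succ_ne_zero
  have hsum : ∑ k ∈ Finset.range (n + 1), (b ^ k - b ^ (n + 1)) =
      ∑ k ∈ Finset.range (n + 1), b ^ k - ((n + 1 : ℕ) : ℂ) • b ^ (n + 1) := by
    rw [Finset.sum_sub_distrib, Finset.sum_const, Finset.card_range, ← Nat.cast_smul_eq_nsmul ℂ]
  have hdiff (s c : H →L[ℂ] H) {m m' : ℂ} (hm : m ≠ 0) (hm' : m' ≠ 0) (h : m' = m + 1) :
      m⁻¹ • s - m'⁻¹ • (s + c) = (m'⁻¹ * m⁻¹) • (s - m • c) := by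
    have e : m⁻¹ = m'⁻¹ + m'⁻¹ * m⁻¹ := by field_simp; exact h
    rw [smul_sub, smul_smul, mul_assoc, inv_mul_cancel₀ hm, mul_one, smul_add]
    nth_rw 1 [e]
    rw [add_smul]
    abel
  rw [← sub_nonneg, Finset.sum_range_succ _ (n + 1), hdiff _ _ hn hn' (by push_cast; ring), ← hsum]
  refine smul_nonneg ?_ (Finset.sum_nonneg fun k hk => sub_nonneg.2 ?_)
  · rw [← mul_inv, ← Nat.cast_mul, ← Complex.ofReal_natCast, ← Complex.ofReal_inv]
    exact Complex.zero_le_real.2 (by positivity)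
  · exact CStarAlgebra.pow_antitone h0 h1 (Finset.mem_range.1 hk).le

/-- An element `a` of `A` between `0` and `1` has a range projection in `A`, and it is annihilated
by every normal state annihilating `a`. -/
lemma exists_range_projection {a : H →L[ℂ] H} (ha : a ∈ A) (h0 : 0 ≤ a) (h1 : a ≤ 1) :
    ∃ R, IsProj A R ∧ a * (1 - R) = 0 ∧
      ∀ φ, IsNormalState A φ → φ a = 0 → φ R = 0 := by
  set b := 1 - a with hb
  have hb0 : 0 ≤ b := sub_nonneg.2 h1
  have hb1 : b ≤ 1 := sub_le_self _ h0
  have hbA : b ∈ A := sub_mem (one_mem A) ha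
  have hnorm : ‖b‖ ≤ 1 := (CStarAlgebra.norm_le_one_iff_of_nonneg b hb0).2 hb1
  set K : Submodule ℂ H := b.eqLocus (1 : H →L[ℂ] H)
  set f : ℕ → H →L[ℂ] H := fun n =>
    1 - ((n + 1 : ℕ) : ℂ)⁻¹ • ∑ k ∈ Finset.range (n + 1), b ^ k
  have hfA n : f n ∈ A :=
    sub_mem (one_mem A) (smul_mem _ (sum_mem fun k _ => pow_mem hbA k))
  have hfm : Monotone f := fun m n hmn =>
    sub_le_sub_left (antitone_average_pow hb0 hb1 hmn) _
  have hlim (η : H) : Tendsto (fun n => f n η) atTop (𝓝 ((1 - K.starProjection) η)) := by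
    have := (b.tendsto_birkhoffAverage_orthogonalProjection hnorm η).comp (tendsto_add_atTop_nat 1)
    refine (tendsto_const_nhds (x := η)).sub (this.congr fun n => ?_)
    simp [birkhoffAverage, birkhoffSum, Module.End.pow_apply]
  refine ⟨1 - K.starProjection, ⟨mem_of_tendsto_apply hfA hlim,
    isStarProjection_starProjection.one_sub.isSelfAdjoint,
    isStarProjection_starProjection.one_sub.isIdempotentElem⟩, ?_, fun φ hφ ha0 => ?_⟩
  · ext η
    have hK : K.starProjection η ∈ K := by simp
    have : b (K.starProjection η) = K.starProjection η := hK
    simpa [hb] using this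
  · have hpow k : φ (1 - b ^ k) = 0 := by
      induction k with
      | zero => simpa using hφ.linear.map_zero
      | succ k ih =>
        have hc : Commute (b ^ k) a := by
          rw [hb]; exact ((Commute.one_left a).sub_left (Commute.refl a)).pow_left k
        have e1 : 0 ≤ b ^ k * a := hc.mul_nonneg (CStarAlgebra.pow_nonneg hb0 k) h0
        have e2 : b ^ k * a ≤ a := by
          have : b ^ k ≤ 1 := by simpa using CStarAlgebra.pow_antitone hb0 hb1 (Nat.zero_le k)
          have := ((Commute.one_left a).sub_left hc).mul_nonneg (sub_nonneg.2 this) h0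
          rwa [sub_mul, one_mul, sub_nonneg] at this
        have e3 : 1 - b ^ (k + 1) = (1 - b ^ k) + b ^ k * a := by
          rw [pow_succ]; nth_rw 2 [hb]; noncomm_ring
        rw [e3, hφ.linear.map_add, ih, hφ.eq_zero_of_le e1 e2 ha0, add_zero]
    have hfz n : φ (f n) = 0 := by
      have hn : ((n + 1 : ℕ) : ℂ) ≠ 0 := by exact_mod_cast n.succ_ne_zero
      have : f n = ((n + 1 : ℕ) : ℂ)⁻¹ • ∑ k ∈ Finset.range (n + 1), (1 - b ^ k) := by
        rw [Finset.sum_sub_distrib, Finset.sum_const, Finset.card_range, smul_sub,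
          ← Nat.cast_smul_eq_nsmul ℂ, inv_smul_smul₀ hn]
      rw [this, ← hφ.toPositiveLinearMap_apply, _root_.map_smul, _root_.map_sum]
      simp [hφ.toPositiveLinearMap_apply, hpow]
    exact tendsto_nhds_unique (hφ.normal f _ hfA hfm hlim) (by simp [hfz])

lemma IsProj.le_one (hp : IsProj A p) : p ≤ 1 :=
  sub_nonneg.1 hp.isStarProjection.one_sub.nonneg

/-- A sequence of projections of `A` has an upper bound among the projections of `A` that is
annihilated by every normal state annihilating the sequence. -/
lemma exists_projection_forall_le (p : ℕ → H →L[ℂ] H) (hp : ∀ n, IsProj A (p n)) :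
    ∃ R, IsProj A R ∧ (∀ n, p n ≤ R) ∧
      ∀ φ, IsNormalState A φ → (∀ n, φ (p n) = 0) → φ R = 0 := by
  set w : ℕ → ℝ := fun n => 1 / 2 / 2 ^ n
  have hw0 n : 0 < w n := by positivity
  have hwc n : 0 ≤ (w n : ℂ) := Complex.zero_le_real.2 (hw0 n).le
  have hwsum : HasSum w 1 := hasSum_geometric_two' 1
  have hterm n : 0 ≤ (w n : ℂ) • p n := smul_nonneg (hwc n) (hp n).isStarProjection.nonneg
  have hsummable : Summable fun n => (w n : ℂ) • p n := by
    refine hwsum.summable.of_norm_bounded fun n => ?_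
    rw [norm_smul, Complex.norm_real, Real.norm_of_nonneg (hw0 n).le]
    exact mul_le_of_le_one_right (hw0 n).le
      ((CStarAlgebra.norm_le_one_iff_of_nonneg _ (hp n).isStarProjection.nonneg).2 (hp n).le_one)
  obtain ⟨a, ha⟩ := hsummable
  have hlim := ha.tendsto_sum_nat
  have hlim' (η : H) : Tendsto (fun N => (∑ n ∈ Finset.range N, (w n : ℂ) • p n) η) atTop
      (𝓝 (a η)) :=
    ((ContinuousLinearMap.apply ℂ H η).continuous.tendsto _).comp hlim
  have hmem N : ∑ n ∈ Finset.range N, (w n : ℂ) • p n ∈ A :=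
    sum_mem fun n _ => smul_mem _ (hp n).1
  have hmono : Monotone fun N => ∑ n ∈ Finset.range N, (w n : ℂ) • p n :=
    monotone_nat_of_le_succ fun N => by
      rw [Finset.sum_range_succ]; exact le_add_of_nonneg_right (hterm N)
  have ha1 : a ≤ 1 := by
    have h1 : HasSum (fun n => (w n : ℂ) • (1 : H →L[ℂ] H)) 1 := by
      simpa using (Complex.hasSum_ofReal.2 hwsum).smul_const (1 : H →L[ℂ] H)
    exact hasSum_le (fun n => smul_le_smul_of_nonneg_left (hp n).le_one (hwc n)) ha h1
  obtain ⟨R, hR, haR, hnull⟩ := exists_range_projection (mem_of_tendsto_apply hmem hlim')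
    (ha.nonneg hterm) ha1
  refine ⟨R, hR, fun n => ?_, fun φ hφ hφp => hnull φ hφ ?_⟩
  · have hle : (w n : ℂ) • p n ≤ a := le_hasSum ha n fun m _ => hterm m
    have h1 := star_left_conjugate_le_conjugate hle (1 - R)
    have h0 := star_left_conjugate_nonneg (hterm n) (1 - R)
    rw [mul_assoc (star (1 - R)) a, haR, mul_zero] at h1
    have h2 := le_antisymm h1 h0
    rw [mul_smul_comm, smul_mul_assoc,
      smul_eq_zero_iff_right (Complex.ofReal_ne_zero.2 (hw0 n).ne')] at h2
    have h3 : star (p n * (1 - R)) * (p n * (1 - R)) = 0 := by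
      rw [star_mul, (hp n).2.1.star_eq, ← h2]
      simp only [mul_assoc]
      rw [← mul_assoc (p n) (p n), (hp n).2.2.eq]
    rw [CStarRing.star_mul_self_eq_zero_iff, mul_sub, mul_one, sub_eq_zero] at h3
    exact ((hp n).isStarProjection.le_iff_mul_eq_left hR.isStarProjection).2 h3.symm
  · refine tendsto_nhds_unique (hφ.normal _ a hmem hmono hlim') ?_
    have h0 N : φ (∑ n ∈ Finset.range N, (w n : ℂ) • p n) = 0 := by
      rw [← hφ.toPositiveLinearMap_apply, map_sum]
      refine Finset.sum_eq_zero fun n _ => ?_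
      rw [hφ.toPositiveLinearMap_apply, hφ.linear.map_smul, hφp, smul_zero]
    exact tendsto_const_nhds.congr fun N => (h0 N).symm

/-- In the presence of a faithful normal state, a nonempty set of projections of `A` which is
countably directed has a greatest element. -/
lemma exists_greatest_projection {ψ : (H →L[ℂ] H) → ℂ} (hψ : IsNormalState A ψ)
    (hfaith : ∀ x ∈ A, ψ (star x * x) = 0 → x = 0) {P : Set (H →L[ℂ] H)}
    (hP : ∀ p ∈ P, IsProj A p) (hne : P.Nonempty)
    (hdir : ∀ p : ℕ → H →L[ℂ] H, (∀ n, p n ∈ P) → ∃ R ∈ P, ∀ n, p n ≤ R) :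
    ∃ R, IsGreatest P R := by
  set S : Set ℝ := (fun p => (ψ p).re) '' P
  have hbdd : BddAbove S := by
    refine ⟨1, ?_⟩
    rintro _ ⟨p, hp, rfl⟩
    simpa [hψ.unital] using (Complex.le_def.1 (hψ.mono (hP p hp).le_one)).1
  obtain ⟨u, -, hu, huS⟩ := exists_seq_tendsto_sSup (hne.image _) hbdd
  choose p hpP hpu using huS
  obtain ⟨R, hRP, hR⟩ := hdir p hpP
  refine ⟨R, hRP, fun q hq => ?_⟩
  obtain ⟨R', hRP', hR'⟩ := hdir (fun n => if n = 0 then R else q)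
    fun n => by split_ifs <;> assumption
  have hRR' : R ≤ R' := by simpa using hR' 0
  have hqR' : q ≤ R' := by simpa using hR' 1
  have hge : sSup S ≤ (ψ R).re := le_of_tendsto' hu fun n => by
    rw [← hpu]; exact (Complex.le_def.1 (hψ.mono (hR n))).1
  have hle : (ψ R').re ≤ sSup S := le_csSup hbdd ⟨R', hRP', rfl⟩
  have hproj := ((hP R hRP).isStarProjection.le_iff_sub (hP R' hRP').isStarProjection).1 hRR'
  have hzero : ψ (R' - R) = 0 := by
    refine le_antisymm ?_ (hψ.nonneg hproj.nonneg)
    have h0 := Complex.le_def.1 (hψ.nonneg hproj.nonneg)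
    refine Complex.le_def.2 ⟨?_, h0.2.symm⟩
    rw [hψ.map_sub, Complex.sub_re, Complex.zero_re]
    linarith
  have heq : R' - R = 0 := hfaith _ (sub_mem (hP R' hRP').1 (hP R hRP).1) (by
    rw [hproj.isSelfAdjoint.star_eq, hproj.isIdempotentElem.eq, hzero])
  rwa [← sub_eq_zero.1 heq]

lemma IsNormalState.map_compress (hφ : IsNormalState A φ) (hq : IsProj A q) (h : φ (1 - q) = 0)
    (x : H →L[ℂ] H) : φ x = φ (q * x * q) := by
  have hq' := hq.isStarProjection.one_sub
  have h0 : φ (star (1 - q) * (1 - q)) = 0 := by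
    rwa [hq'.isSelfAdjoint.star_eq, hq'.isIdempotentElem.eq]
  have h1 := hφ.map_star_mul_eq_zero h0 x
  have h2 := hφ.map_star_mul_eq_zero' h0 (star (q * x))
  rw [hq'.isSelfAdjoint.star_eq] at h1
  rw [star_star] at h2
  rw [← sub_eq_zero, ← hφ.map_sub,
    show x - q * x * q = (1 - q) * x + q * x * (1 - q) by noncomm_ring, hφ.linear.map_add, h1, h2,
    add_zero]

lemma IsStateSupport.map_one_sub (hφ : IsNormalState A φ) {s : H →L[ℂ] H}
    (hs : IsStateSupport A φ s) : φ (1 - s) = 0 := by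
  rw [hφ.map_sub, hs.2.1 1 (one_mem A), mul_one, hs.1.2.2.eq, sub_self]

lemma IsStateSupport.le_of_map_one_sub (hφ : IsNormalState A φ) {s : H →L[ℂ] H}
    (hs : IsStateSupport A φ s) (hq : IsProj A q) (h : φ (1 - q) = 0) : s ≤ q :=
  hs.2.2 q hq fun x _ => hφ.map_compress hq h x

/-- Every normal state on a σ-finite von Neumann algebra has a support projection. -/
lemma IsNormalState.exists_support {ψ : (H →L[ℂ] H) → ℂ} (hψ : IsNormalState A ψ)
    (hfaith : ∀ x ∈ A, ψ (star x * x) = 0 → x = 0) (hφ : IsNormalState A φ) :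
    ∃ s, IsStateSupport A φ s := by
  obtain ⟨R, ⟨hR, hR0⟩, hmax⟩ := exists_greatest_projection hψ hfaith
    (P := {p | IsProj A p ∧ φ p = 0}) (fun p hp => hp.1)
    ⟨0, ⟨zero_mem A, .zero _, .zero⟩, hφ.linear.map_zero⟩ fun p hp => by
      obtain ⟨R, hR, hle, hnull⟩ := exists_projection_forall_le p fun n => (hp n).1
      exact ⟨R, ⟨hR, hnull φ hφ fun n => (hp n).2⟩, hle⟩
  refine ⟨1 - R, hR.one_sub, fun x _ => hφ.map_compress hR.one_sub (by simpa using hR0) x,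
    fun q hq h => sub_le_comm.1 (hmax ⟨hq.one_sub, ?_⟩)⟩
  rw [hφ.map_sub, h 1 (one_mem A), mul_one, hq.2.2.eq, sub_self]

lemma summable_mixture {φ : ℕ → (H →L[ℂ] H) → ℂ} (hφ : ∀ n, IsNormalState A (φ n))
    (x : H →L[ℂ] H) : Summable fun n => ((1 / 2 / 2 ^ n : ℝ) : ℂ) * φ n x := by
  refine ((summable_geometric_two' 1).mul_right ‖x‖).of_norm_bounded fun n => ?_
  rw [norm_mul, Complex.norm_real, Real.norm_of_nonneg (by positivity)]
  exact mul_le_mul_of_nonneg_left ((hφ n).norm_le x) (by positivity)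

/-- A countable convex combination of normal states is a normal state. -/
lemma isNormalState_mixture {φ : ℕ → (H →L[ℂ] H) → ℂ} (hφ : ∀ n, IsNormalState A (φ n)) :
    IsNormalState A fun x => ∑' n, ((1 / 2 / 2 ^ n : ℝ) : ℂ) * φ n x where
  linear := by
    constructor
    · intro x y
      rw [← (summable_mixture hφ x).tsum_add (summable_mixture hφ y)]
      exact tsum_congr fun n => by rw [(hφ n).linear.map_add, mul_add]
    · intro c x
      rw [smul_eq_mul, ← tsum_mul_left]
      exact tsum_congr fun n => by rw [(hφ n).linear.map_smul, smul_eq_mul, mul_left_comm]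
  unital := by
    simp only [(hφ _).unital, mul_one]
    rw [← Complex.ofReal_tsum, tsum_geometric_two', Complex.ofReal_one]
  pos x hx := by
    choose r hr hrx using fun n => (hφ n).pos x hx
    refine ⟨∑' n, 1 / 2 / 2 ^ n * r n, tsum_nonneg fun n => mul_nonneg (by positivity) (hr n), ?_⟩
    rw [Complex.ofReal_tsum]
    exact tsum_congr fun n => by rw [hrx, Complex.ofReal_mul]
  normal f y hf hmono hlim := by
    obtain ⟨C, hC⟩ := banach_steinhaus fun η => by
      obtain ⟨C, hC⟩ := (hlim η).norm.bddAbove_range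
      exact ⟨C, fun n => hC ⟨n, rfl⟩⟩
    refine tendsto_tsum_of_dominated_convergence ((summable_geometric_two' 1).mul_right C)
      (fun n => ((hφ n).normal f y hf hmono hlim).const_mul _) (.of_forall fun k n => ?_)
    rw [norm_mul, Complex.norm_real, Real.norm_of_nonneg (by positivity)]
    exact mul_le_mul_of_nonneg_left (((hφ n).norm_le _).trans (hC k)) (by positivity)

lemma eq_zero_of_mixture_eq_zero {φ : ℕ → (H →L[ℂ] H) → ℂ} (hφ : ∀ n, IsNormalState A (φ n))
    {x : H →L[ℂ] H} (hx : 0 ≤ x) (h : ∑' n, ((1 / 2 / 2 ^ n : ℝ) : ℂ) * φ n x = 0) (n : ℕ) :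
    φ n x = 0 := by
  have hw (m : ℕ) : 0 < (1 / 2 / 2 ^ m : ℝ) := by positivity
  have h0 (m : ℕ) : 0 ≤ ((1 / 2 / 2 ^ m : ℝ) : ℂ) * φ m x :=
    mul_nonneg (Complex.zero_le_real.2 (hw m).le) ((hφ m).nonneg hx)
  have := (summable_mixture hφ x).le_tsum n fun m _ => h0 m
  rw [h] at this
  exact (mul_eq_zero.1 (le_antisymm this (h0 n))).resolve_left
    (Complex.ofReal_ne_zero.2 (hw n).ne')

end
end QMP

open QMP

/-- If `A` is σ-finite and `T` admits a stationary normal state, then the maximal positive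
recurrent projection `p_R` is the support of a single stationary normal state. -/
theorem maxPosRecurrent_is_support_of_state
    {H : Type*} [NormedAddCommGroup H] [InnerProductSpace ℂ H] [CompleteSpace H]
    (A : VonNeumannAlgebra H) (T : (H →L[ℂ] H) → (H →L[ℂ] H)) (hT : IsMarkov A T)
    (hσ : ∃ ψ, IsNormalState A ψ ∧ ∀ x ∈ A, ψ (star x * x) = 0 → x = 0)
    (hstat : ∃ φ, IsNormalState A φ ∧ Stationary T φ)
    (r : H →L[ℂ] H) (hr : IsMaxPosRecurrent A T r) :
    ∃ φ, IsNormalState A φ ∧ Stationary T φ ∧ IsStateSupport A φ r := by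
  obtain ⟨ψ, hψ, hfaith⟩ := hσ
  obtain ⟨φ₀, hφ₀, hT₀⟩ := hstat
  obtain ⟨s₀, hs₀⟩ := hψ.exists_support hfaith hφ₀
  obtain ⟨s, ⟨φ, hφ, hφT, hs⟩, hmax⟩ := exists_greatest_projection hψ hfaith
    (P := {s | ∃ φ, IsNormalState A φ ∧ Stationary T φ ∧ IsStateSupport A φ s})
    (fun s ⟨φ, _, _, hs⟩ => hs.1) ⟨s₀, φ₀, hφ₀, hT₀, hs₀⟩ fun p hp => by
      choose φ hφ hφT hs using hp
      have hmix := isNormalState_mixture hφ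
      obtain ⟨s, hsupp⟩ := hψ.exists_support hfaith hmix
      refine ⟨s, ⟨_, hmix, fun x => tsum_congr fun n => by rw [hφT n x], hsupp⟩, fun n => ?_⟩
      exact (hs n).le_of_map_one_sub (hφ n) hsupp.1 (eq_zero_of_mixture_eq_zero hφ
        hsupp.1.one_sub.isStarProjection.nonneg (hsupp.map_one_sub hmix) n)
  have hrs : r = s := le_antisymm
    (hr.2.2 s hs.1 fun φ' s' h₁ h₂ h₃ => hmax ⟨φ', h₁, h₂, h₃⟩) (hr.2.1 φ s hφ hφT hs)
  exact ⟨φ, hφ, hφT, hrs ▸ hs⟩
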